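/- arXiv:0910.3817 — 8 statements merged into one kernel-verified Lean document; each statement's English description precedes it below -/
import Mathlib

section
/- Let K be a unital commutative ring, q ∈ K, and N ≥ 2 an integer. If [N]_q = 0 and [n]_q is invertible in K for all 1 ≤ n ≤ N−1, then the q-binomial coefficients satisfy [N choose p]_q = 0 for every p with 1 ≤ p ≤ N−1. -/
/-- The `q`-integer `[n]_q = 1 + q + … + q^{n-1}`, with `[0]_q = 0`. -/
def qInt {K : Type*} [CommRing K] (q : K) (n : ℕ) : K :=
  ∑ k ∈ Finset.range n, q ^ k

/-- The `q`-binomial coefficients, defined inductively by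
`[n choose 0]_q = [n choose n]_q = 1` and the `q`-Pascal recursion
`[n choose m]_q + q^{m+1} [n choose m+1]_q = [n+1 choose m+1]_q`. -/
def qBinom {K : Type*} [CommRing K] (q : K) : ℕ → ℕ → K
  | _, 0 => 1
  | 0, _ + 1 => 0
  | n + 1, m + 1 => qBinom q n m + q ^ (m + 1) * qBinom q n (m + 1)

theorem qInt_succ {K : Type*} [CommRing K] (q : K) (n : ℕ) :
    qInt q (n + 1) = 1 + q * qInt q n := by
  simp only [qInt, Finset.sum_range_succ', Finset.mul_sum, pow_succ', pow_zero, add_comm]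

/-- The absorption identity `[m+1]_q [n+1 choose m+1]_q = [n+1]_q [n choose m]_q`. -/
theorem qInt_mul_qBinom_succ {K : Type*} [CommRing K] (q : K) (n m : ℕ) :
    qInt q (m + 1) * qBinom q (n + 1) (m + 1) = qInt q (n + 1) * qBinom q n m := by
  induction n generalizing m with
  | zero => cases m <;> simp [qBinom, qInt]
  | succ n ih =>
    rw [qBinom, mul_add, mul_left_comm, ih, qInt_succ q (n + 1)]
    cases m with
    | zero =>
      simp [qBinom, qInt]
    | succ m =>
      rw [qInt_succ q (m + 1), add_mul, mul_assoc, ih, qBinom]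
      ring

/-- If `[N]_q = 0` and `[n]_q` is invertible for `1 ≤ n ≤ N-1`, then
`[N choose p]_q = 0` for every `1 ≤ p ≤ N-1`. -/
theorem qBinom_eq_zero {K : Type*} [CommRing K] (q : K) (N : ℕ) (hN : 2 ≤ N)
    (hNq : qInt q N = 0)
    (hinv : ∀ n : ℕ, 1 ≤ n → n ≤ N - 1 → IsUnit (qInt q n)) :
    ∀ p : ℕ, 1 ≤ p → p ≤ N - 1 → qBinom q N p = 0 := by
  intro p hp hpN
  obtain ⟨n, rfl⟩ := Nat.exists_eq_add_of_le' (one_le_two.trans hN)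
  obtain ⟨m, rfl⟩ := Nat.exists_eq_add_of_le' hp
  rw [← (hinv (m + 1) hp hpN).mul_right_eq_zero, qInt_mul_qBinom_succ, hNq, zero_mul]
end

section
/- Let K be a unital commutative ring, q ∈ K, and let C₀ = ⊕_{n∈ℤ} C₀ⁿ and C₁ = ⊕_{n∈ℤ} C₁ⁿ be ℤ-graded K-modules equipped with K-linear endomorphisms d₀, d₁, each homogeneous of degree 1. Define the K-linear endomorphism d of the graded tensor product C₀ ⊗ C₁ (with (C₀⊗C₁)ⁿ = ⊕_{r+s=n} C₀ʳ ⊗ C₁ˢ) by d(x₀ ⊗ x₁) = d₀(x₀) ⊗ x₁ + qⁿ · x₀ ⊗ d₁(x₁) for x₀ ∈ C₀ⁿ and x₁ ∈ C₁. Then for every k ≥ 0, every n ∈ ℤ, every x₀ ∈ C₀ⁿ and x₁ ∈ C₁: d^k(x₀ ⊗ x₁) = Σ_{p=0}^{k} q^{n(k−p)} [k choose p]_q · d₀^p(x₀) ⊗ d₁^{k−p}(x₁). -/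
open TensorProduct

theorem qBinom_zero_right {K : Type*} [CommRing K] (q : K) (n : ℕ) : qBinom q n 0 = 1 := by
  cases n <;> rfl

theorem qBinom_succ_succ {K : Type*} [CommRing K] (q : K) (n m : ℕ) :
    qBinom q (n + 1) (m + 1) = qBinom q n m + q ^ (m + 1) * qBinom q n (m + 1) :=
  rfl

theorem qBinom_eq_zero_of_lt {K : Type*} [CommRing K] (q : K) {n m : ℕ} (h : n < m) :
    qBinom q n m = 0 := by
  induction n generalizing m with
  | zero =>
    obtain ⟨m, rfl⟩ := Nat.exists_eq_succ_of_ne_zero h.ne'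
    rfl
  | succ n ih =>
    obtain ⟨m, rfl⟩ := Nat.exists_eq_succ_of_ne_zero (Nat.ne_zero_of_lt h)
    rw [Nat.succ_eq_add_one, qBinom_succ_succ, ih (by omega), ih (by omega), mul_zero, add_zero]

/-- Iterating an endomorphism of degree one `p` times raises the degree by `p`. -/
theorem pow_apply_mem_of_degree_one {K M : Type*} [CommRing K] [AddCommGroup M] [Module K M]
    {𝒜 : ℤ → Submodule K M} {d : Module.End K M}
    (hd : ∀ (n : ℤ), ∀ x ∈ 𝒜 n, d x ∈ 𝒜 (n + 1)) {n : ℤ} {x : M} (hx : x ∈ 𝒜 n) (p : ℕ) :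
    (d ^ p) x ∈ 𝒜 (n + p) := by
  induction p with
  | zero => simpa using hx
  | succ p ih =>
    rw [pow_succ', Module.End.mul_apply, Nat.cast_succ, ← add_assoc]
    exact hd _ _ ih

/-- Let `C₀`, `C₁` be `ℤ`-graded `K`-modules with degree-1 endomorphisms
`d₀`, `d₁`, and let `D` be the endomorphism of `C₀ ⊗ C₁` determined by
`D (x₀ ⊗ x₁) = d₀ x₀ ⊗ x₁ + qⁿ • x₀ ⊗ d₁ x₁` for `x₀` of degree `n`.
Then `D^k (x₀ ⊗ x₁) = Σ_{p=0}^k q^{n(k-p)} [k choose p]_q • d₀^p x₀ ⊗ d₁^{k-p} x₁`.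
(Since the grading group is `ℤ`, the scalar `qⁿ` is interpreted via a unit
`q : Kˣ`.) -/
theorem pow_tensor_differential {K : Type*} [CommRing K] (q : Kˣ)
    {C₀ C₁ : Type*} [AddCommGroup C₀] [Module K C₀]
    [AddCommGroup C₁] [Module K C₁]
    (𝒜₀ : ℤ → Submodule K C₀) (𝒜₁ : ℤ → Submodule K C₁)
    (hA₀ : DirectSum.IsInternal 𝒜₀) (hA₁ : DirectSum.IsInternal 𝒜₁)
    (d₀ : Module.End K C₀) (d₁ : Module.End K C₁)
    (hd₀ : ∀ (n : ℤ), ∀ x ∈ 𝒜₀ n, d₀ x ∈ 𝒜₀ (n + 1))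
    (hd₁ : ∀ (n : ℤ), ∀ x ∈ 𝒜₁ n, d₁ x ∈ 𝒜₁ (n + 1))
    (D : Module.End K (C₀ ⊗[K] C₁))
    (hD : ∀ (n : ℤ), ∀ x₀ ∈ 𝒜₀ n, ∀ x₁ : C₁,
      D (x₀ ⊗ₜ[K] x₁) =
        (d₀ x₀) ⊗ₜ[K] x₁ + ((q ^ n : Kˣ) : K) • (x₀ ⊗ₜ[K] (d₁ x₁)))
    (k : ℕ) (n : ℤ) (x₀ : C₀) (hx₀ : x₀ ∈ 𝒜₀ n) (x₁ : C₁) :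
    (D ^ k) (x₀ ⊗ₜ[K] x₁) =
      ∑ p ∈ Finset.range (k + 1),
        (((q ^ (n * ((k - p : ℕ) : ℤ)) : Kˣ) : K) * qBinom (q : K) k p) •
          ((d₀ ^ p) x₀ ⊗ₜ[K] (d₁ ^ (k - p)) x₁) := by
  induction k with
  | zero => simp [qBinom_zero_right]
  | succ k ih =>
    let A : ℕ → C₀ ⊗[K] C₁ := fun p ↦
      (((q ^ (n * ((k - p : ℕ) : ℤ)) : Kˣ) : K) * qBinom (q : K) k p) •
        ((d₀ ^ (p + 1)) x₀ ⊗ₜ[K] (d₁ ^ (k - p)) x₁)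
    let B : ℕ → C₀ ⊗[K] C₁ := fun p ↦
      (((q ^ (n * ((k + 1 - p : ℕ) : ℤ)) : Kˣ) : K) * ((q : K) ^ p * qBinom (q : K) k p)) •
        ((d₀ ^ p) x₀ ⊗ₜ[K] (d₁ ^ (k + 1 - p)) x₁)
    have hB : B (k + 1) = 0 := by
      simp [B, qBinom_eq_zero_of_lt (q : K) k.lt_succ_self]
    have hD_term : ∀ p ∈ Finset.range (k + 1),
        D ((((q ^ (n * ((k - p : ℕ) : ℤ)) : Kˣ) : K) * qBinom (q : K) k p) •
          ((d₀ ^ p) x₀ ⊗ₜ[K] (d₁ ^ (k - p)) x₁)) = A p + B p := by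
      intro p hp
      have hpk : k + 1 - p = (k - p) + 1 := by
        have := Finset.mem_range.mp hp
        omega
      have hq : ((q ^ (n * ((k + 1 - p : ℕ) : ℤ)) : Kˣ) : K) * (q : K) ^ p =
          ((q ^ (n * ((k - p : ℕ) : ℤ)) : Kˣ) : K) * ((q ^ (n + p) : Kˣ) : K) := by
        rw [← Units.val_pow_eq_pow_val, ← Units.val_mul, ← Units.val_mul, ← zpow_natCast q p,
          ← zpow_add, ← zpow_add, hpk, Nat.cast_succ]
        ring_nf
      simp only [A, B]
      rw [map_smul, hD _ _ (pow_apply_mem_of_degree_one hd₀ hx₀ p), smul_add, smul_smul,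
        ← mul_assoc, hq, hpk, pow_succ' d₀, pow_succ' d₁, Module.End.mul_apply,
        Module.End.mul_apply, mul_right_comm]
    have h_zero : (((q ^ (n * ((k + 1 - 0 : ℕ) : ℤ)) : Kˣ) : K) * qBinom (q : K) (k + 1) 0) •
        ((d₀ ^ 0) x₀ ⊗ₜ[K] (d₁ ^ (k + 1 - 0)) x₁) = B 0 := by
      simp [B, qBinom_zero_right]
    have h_succ : ∀ p, (((q ^ (n * ((k + 1 - (p + 1) : ℕ) : ℤ)) : Kˣ) : K) *
        qBinom (q : K) (k + 1) (p + 1)) •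
        ((d₀ ^ (p + 1)) x₀ ⊗ₜ[K] (d₁ ^ (k + 1 - (p + 1))) x₁) = A p + B (p + 1) := by
      intro p
      simp only [A, B]
      rw [qBinom_succ_succ, mul_add, add_smul, Nat.add_sub_add_right]
    rw [pow_succ', Module.End.mul_apply, ih, map_sum, Finset.sum_congr rfl hD_term,
      Finset.sum_range_succ' _ (k + 1), h_zero, Finset.sum_congr rfl fun p _ ↦ h_succ p,
      Finset.sum_add_distrib, Finset.sum_add_distrib, add_assoc, ← Finset.sum_range_succ' B,
      Finset.sum_range_succ B (k + 1), hB, add_zero]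
end

section
/- Let K be a unital commutative ring, N ≥ 2, let C be a K-module and d a K-linear endomorphism of C with d^N = 0. Let ℓ, m ≥ 1 with ℓ + m ≤ N − 1. Then the generalized-cohomology hexagon is exact at H_(ℓ+m): for every x ∈ C with d^{ℓ+m}(x) = 0, one has d^m(x) ∈ d^{N−ℓ}(C) if and only if there exist y, z ∈ C with d^m(y) = 0 and x = y + d^{N−ℓ−m}(z). -/
/-- Exactness of the generalized-cohomology hexagon at `H_(ℓ+m)`:
for an `N`-complex `(C, d)` (`d^N = 0`) and `x ∈ ker d^{ℓ+m}`, the class of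
`d^m x` vanishes in `H_(ℓ)` iff the class of `x` comes from `H_(m)`. -/
theorem hexagon_exact_at_sum {K : Type*} [CommRing K]
    {C : Type*} [AddCommGroup C] [Module K C]
    (N : ℕ) (hN : 2 ≤ N) (d : Module.End K C) (hd : d ^ N = 0)
    (ℓ m : ℕ) (hℓ : 1 ≤ ℓ) (hm : 1 ≤ m) (hlm : ℓ + m ≤ N - 1)
    (x : C) (hx : (d ^ (ℓ + m)) x = 0) :
    (d ^ m) x ∈ LinearMap.range (d ^ (N - ℓ)) ↔
      ∃ y z : C, (d ^ m) y = 0 ∧ x = y + (d ^ (N - ℓ - m)) z := by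
  have hcomp : ∀ z : C, (d ^ m) ((d ^ (N - ℓ - m)) z) = (d ^ (N - ℓ)) z := fun z => by
    rw [← Module.End.mul_apply, ← pow_add, show m + (N - ℓ - m) = N - ℓ by omega]
  constructor
  · rintro ⟨z, hz⟩
    refine ⟨x - (d ^ (N - ℓ - m)) z, z, ?_, (sub_add_cancel _ _).symm⟩
    rw [map_sub, hcomp, hz, sub_self]
  · rintro ⟨y, z, hy, rfl⟩
    exact ⟨z, by rw [map_add, hy, hcomp, zero_add]⟩
end

section
/- Let K be a unital commutative ring, N ≥ 2, let C be a K-module and d a K-linear endomorphism of C with d^N = 0. Let ℓ, m ≥ 1 with ℓ + m ≤ N − 1. Then the generalized-cohomology hexagon is exact at H_(ℓ): for every x ∈ C with d^ℓ(x) = 0, one has x ∈ d^m(C) if and only if there exists z ∈ C with d^{ℓ+m}(z) = 0 and x − d^m(z) ∈ d^{N−ℓ}(C). -/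
/-- Exactness of the generalized-cohomology hexagon at `H_(ℓ)`:
for an `N`-complex `(C, d)` (`d^N = 0`) and `x ∈ ker d^ℓ`, the class of `x`
dies under `[i]^{N-(ℓ+m)}` iff it lies in the image of `[d]^m`. -/
theorem hexagon_exact_at_ell {K : Type*} [CommRing K]
    {C : Type*} [AddCommGroup C] [Module K C]
    (N : ℕ) (hN : 2 ≤ N) (d : Module.End K C) (hd : d ^ N = 0)
    (ℓ m : ℕ) (hℓ : 1 ≤ ℓ) (hm : 1 ≤ m) (hlm : ℓ + m ≤ N - 1)
    (x : C) (hx : (d ^ ℓ) x = 0) :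
    x ∈ LinearMap.range (d ^ m) ↔
      ∃ z : C, (d ^ (ℓ + m)) z = 0 ∧
        x - (d ^ m) z ∈ LinearMap.range (d ^ (N - ℓ)) := by
  constructor
  · rintro ⟨z, rfl⟩
    refine ⟨z, ?_, ?_⟩
    · rw [pow_add, Module.End.mul_apply, hx]
    · rw [sub_self]
      exact Submodule.zero_mem _
  · rintro ⟨z, -, w, hw⟩
    refine ⟨z + (d ^ (N - ℓ - m)) w, ?_⟩
    have h : N - ℓ = m + (N - ℓ - m) := by omega
    rw [map_add, ← Module.End.mul_apply, ← pow_add, ← h, hw, add_sub_cancel]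
end

section
/- Let K be a unital commutative ring, N ≥ 2, and let (C₁,d₁), (C₂,d₂), (C₃,d₃) be K-modules with K-linear endomorphisms satisfying d_i^N = 0. Let α : C₁ → C₂ be injective and β : C₂ → C₃ be surjective K-linear maps with im(α) = ker(β), α∘d₁ = d₂∘α and β∘d₂ = d₃∘β. Fix 1 ≤ n ≤ N−1. Then the connecting homomorphism ∂ : H_(n)(C₃) → H_(N−n)(C₁) is well defined: (i) for every x₃ ∈ C₃ with d₃ⁿ(x₃) = 0 and every x₂ ∈ C₂ with β(x₂) = x₃, there exists x₁ ∈ C₁ with α(x₁) = d₂ⁿ(x₂) and d₁^{N−n}(x₁) = 0; (ii) if x₂, x₂′ ∈ C₂ both satisfy β(x₂) = β(x₂′) = x₃ and α(x₁) = d₂ⁿ(x₂), α(x₁′) = d₂ⁿ(x₂′), then x₁ − x₁′ ∈ d₁ⁿ(C₁). -/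
/-- A linear map intertwining two endomorphisms intertwines their powers. -/
theorem map_end_pow_apply {R M M' : Type*} [Semiring R]
    [AddCommMonoid M] [Module R M] [AddCommMonoid M'] [Module R M']
    (f : M →ₗ[R] M') (d : Module.End R M) (d' : Module.End R M')
    (h : ∀ x, f (d x) = d' (f x)) (k : ℕ) (x : M) :
    f ((d ^ k) x) = (d' ^ k) (f x) := by
  simpa only [Module.End.pow_apply] using Function.Semiconj.iterate_right h k x

/-- Well-definedness of the connecting homomorphism
`∂ : H_(n)(C₃) → H_(N-n)(C₁)` associated with a short exact sequence
`0 → C₁ →α C₂ →β C₃ → 0` of `N`-complexes: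
(i) any lift `x₂` of `x₃ ∈ ker dⁿ` gives `x₁` with `α x₁ = dⁿ x₂` and
`d^{N-n} x₁ = 0`; (ii) the class of `x₁` modulo `im dⁿ` is independent of
the chosen lift. -/
theorem connecting_hom_well_defined {K : Type*} [CommRing K]
    {C₁ C₂ C₃ : Type*} [AddCommGroup C₁] [Module K C₁]
    [AddCommGroup C₂] [Module K C₂] [AddCommGroup C₃] [Module K C₃]
    (N : ℕ) (hN : 2 ≤ N)
    (d₁ : Module.End K C₁) (d₂ : Module.End K C₂) (d₃ : Module.End K C₃)
    (hd₁ : d₁ ^ N = 0) (hd₂ : d₂ ^ N = 0) (hd₃ : d₃ ^ N = 0)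
    (α : C₁ →ₗ[K] C₂) (β : C₂ →ₗ[K] C₃)
    (hα : Function.Injective α) (hβ : Function.Surjective β)
    (hexact : LinearMap.range α = LinearMap.ker β)
    (hαd : ∀ x : C₁, α (d₁ x) = d₂ (α x))
    (hβd : ∀ x : C₂, β (d₂ x) = d₃ (β x))
    (n : ℕ) (hn1 : 1 ≤ n) (hn2 : n ≤ N - 1) :
    (∀ x₃ : C₃, (d₃ ^ n) x₃ = 0 → ∀ x₂ : C₂, β x₂ = x₃ →
      ∃ x₁ : C₁, α x₁ = (d₂ ^ n) x₂ ∧ (d₁ ^ (N - n)) x₁ = 0) ∧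
    (∀ x₃ : C₃, (d₃ ^ n) x₃ = 0 → ∀ x₂ x₂' : C₂, ∀ x₁ x₁' : C₁,
      β x₂ = x₃ → β x₂' = x₃ →
      α x₁ = (d₂ ^ n) x₂ → α x₁' = (d₂ ^ n) x₂' →
      x₁ - x₁' ∈ LinearMap.range (d₁ ^ n)) := by
  have hker {x : C₂} (hx : β x = 0) : ∃ y, α y = x := by
    rwa [← LinearMap.mem_range, hexact, LinearMap.mem_ker]
  have hαp := map_end_pow_apply α d₁ d₂ hαd
  refine ⟨?_, ?_⟩
  · rintro _ hx x₂ rfl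
    obtain ⟨x₁, hx₁⟩ := hker ((map_end_pow_apply β d₂ d₃ hβd n x₂).trans hx)
    refine ⟨x₁, hx₁, hα ?_⟩
    rw [hαp, hx₁, ← Module.End.mul_apply, ← pow_add, Nat.sub_add_cancel (by omega), hd₂,
      LinearMap.zero_apply, map_zero]
  · intro x₃ _ x₂ x₂' x₁ x₁' h h' h₁ h₁'
    obtain ⟨y, hy⟩ := hker (x := x₂ - x₂') (by rw [map_sub, h, h', sub_self])
    exact ⟨y, hα (by rw [hαp, hy, map_sub, map_sub, h₁, h₁'])⟩
end

section
/- Let K be a unital commutative ring, N ≥ 2, and let 0 → C₁ →α C₂ →β C₃ → 0 be a short exact sequence of N-complexes of K-modules (α injective, β surjective, im(α) = ker(β), both commuting with the N-differentials d, d^N = 0). Fix 1 ≤ n ≤ N−1. Then the long sequence is exact at H_(n)(C₂): for every x₂ ∈ C₂ with dⁿ(x₂) = 0, there exists z₃ ∈ C₃ with β(x₂) = d^{N−n}(z₃) if and only if there exist y₁ ∈ C₁ and z₂ ∈ C₂ with dⁿ(y₁) = 0 and x₂ = α(y₁) + d^{N−n}(z₂). -/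
/-- A linear map that intertwines two endomorphisms intertwines their powers. -/
theorem LinearMap.map_pow_apply_of_intertwines {R M M' : Type*} [Semiring R]
    [AddCommMonoid M] [Module R M] [AddCommMonoid M'] [Module R M']
    {f : M →ₗ[R] M'} {d : Module.End R M} {d' : Module.End R M'}
    (h : ∀ x, f (d x) = d' (f x)) (k : ℕ) (x : M) :
    f ((d ^ k) x) = (d' ^ k) (f x) := by
  rw [Module.End.pow_apply, Module.End.pow_apply]
  exact Function.Semiconj.iterate_right h k x

/-- Exactness of the long sequence at `H_(n)(C₂)` for a short exact sequence
`0 → C₁ →α C₂ →β C₃ → 0` of `N`-complexes: for `x₂ ∈ ker dⁿ`, the class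
`β_*[x₂]` vanishes in `H_(n)(C₃)` iff `[x₂]` lies in the image of `α_*`. -/
theorem long_sequence_exact_at_middle {K : Type*} [CommRing K]
    {C₁ C₂ C₃ : Type*} [AddCommGroup C₁] [Module K C₁]
    [AddCommGroup C₂] [Module K C₂] [AddCommGroup C₃] [Module K C₃]
    (N : ℕ) (hN : 2 ≤ N)
    (d₁ : Module.End K C₁) (d₂ : Module.End K C₂) (d₃ : Module.End K C₃)
    (hd₁ : d₁ ^ N = 0) (hd₂ : d₂ ^ N = 0) (hd₃ : d₃ ^ N = 0)
    (α : C₁ →ₗ[K] C₂) (β : C₂ →ₗ[K] C₃)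
    (hα : Function.Injective α) (hβ : Function.Surjective β)
    (hexact : LinearMap.range α = LinearMap.ker β)
    (hαd : ∀ x : C₁, α (d₁ x) = d₂ (α x))
    (hβd : ∀ x : C₂, β (d₂ x) = d₃ (β x))
    (n : ℕ) (hn1 : 1 ≤ n) (hn2 : n ≤ N - 1) :
    ∀ x₂ : C₂, (d₂ ^ n) x₂ = 0 →
      ((∃ z₃ : C₃, β x₂ = (d₃ ^ (N - n)) z₃) ↔
        (∃ (y₁ : C₁) (z₂ : C₂), (d₁ ^ n) y₁ = 0 ∧
          x₂ = α y₁ + (d₂ ^ (N - n)) z₂)) := by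
  intro x₂ hx₂
  have hpow : ∀ z, (d₂ ^ n) ((d₂ ^ (N - n)) z) = 0 := fun z => by
    rw [← Module.End.mul_apply, ← pow_add, Nat.add_sub_cancel' (by omega), hd₂,
      LinearMap.zero_apply]
  constructor
  · rintro ⟨z₃, hz₃⟩
    obtain ⟨z₂, rfl⟩ := hβ z₃
    have hker : x₂ - (d₂ ^ (N - n)) z₂ ∈ LinearMap.ker β := by
      rw [LinearMap.mem_ker, map_sub, LinearMap.map_pow_apply_of_intertwines hβd, hz₃, sub_self]
    rw [← hexact] at hker
    obtain ⟨y₁, hy₁⟩ := hker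
    refine ⟨y₁, z₂, hα ?_, by rw [hy₁, sub_add_cancel]⟩
    rw [LinearMap.map_pow_apply_of_intertwines hαd, hy₁, map_sub, hx₂, hpow, sub_self, map_zero]
  · rintro ⟨y₁, z₂, -, rfl⟩
    have hy₁ : α y₁ ∈ LinearMap.ker β := hexact ▸ LinearMap.mem_range_self α y₁
    exact ⟨β z₂, by
      rw [map_add, LinearMap.mem_ker.mp hy₁, zero_add,
        LinearMap.map_pow_apply_of_intertwines hβd]⟩
end

section
/- Let K be a unital commutative ring, N ≥ 2, and let 0 → C₁ →α C₂ →β C₃ → 0 be a short exact sequence of N-complexes of K-modules (α injective, β surjective, im(α) = ker(β), both commuting with the N-differentials d, d^N = 0). Fix 1 ≤ n ≤ N−1. Then the long sequence is exact at H_(n)(C₃) with respect to the connecting map: for every x₃ ∈ C₃ with dⁿ(x₃) = 0, the following are equivalent: (i) there exist x₂ ∈ C₂ and x₁′ ∈ C₁ with β(x₂) = x₃ and dⁿ(x₂) = α(dⁿ(x₁′)); (ii) there exist y₂ ∈ C₂ and z₃ ∈ C₃ with dⁿ(y₂) = 0 and x₃ = β(y₂) + d^{N−n}(z₃). -/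
theorem Module.End.pow_apply_comm {K M P : Type*} [CommRing K]
    [AddCommGroup M] [Module K M] [AddCommGroup P] [Module K P]
    {f : Module.End K M} {g : Module.End K P} {φ : M →ₗ[K] P}
    (h : ∀ x, φ (f x) = g (φ x)) (k : ℕ) (x : M) :
    φ ((f ^ k) x) = (g ^ k) (φ x) := by
  simpa only [Module.End.pow_apply] using (Function.Semiconj.iterate_right h k) x

/-- Exactness of the long sequence at `H_(n)(C₃)` for a short exact sequence
`0 → C₁ →α C₂ →β C₃ → 0` of `N`-complexes, with respect to the connecting
homomorphism: for `x₃ ∈ ker dⁿ`, one has `∂[x₃] = 0` iff `[x₃] ∈ im β_*`. -/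
theorem long_sequence_exact_at_connecting {K : Type*} [CommRing K]
    {C₁ C₂ C₃ : Type*} [AddCommGroup C₁] [Module K C₁]
    [AddCommGroup C₂] [Module K C₂] [AddCommGroup C₃] [Module K C₃]
    (N : ℕ) (hN : 2 ≤ N)
    (d₁ : Module.End K C₁) (d₂ : Module.End K C₂) (d₃ : Module.End K C₃)
    (hd₁ : d₁ ^ N = 0) (hd₂ : d₂ ^ N = 0) (hd₃ : d₃ ^ N = 0)
    (α : C₁ →ₗ[K] C₂) (β : C₂ →ₗ[K] C₃)
    (hα : Function.Injective α) (hβ : Function.Surjective β)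
    (hexact : LinearMap.range α = LinearMap.ker β)
    (hαd : ∀ x : C₁, α (d₁ x) = d₂ (α x))
    (hβd : ∀ x : C₂, β (d₂ x) = d₃ (β x))
    (n : ℕ) (hn1 : 1 ≤ n) (hn2 : n ≤ N - 1) :
    ∀ x₃ : C₃, (d₃ ^ n) x₃ = 0 →
      ((∃ (x₂ : C₂) (x₁' : C₁), β x₂ = x₃ ∧ (d₂ ^ n) x₂ = α ((d₁ ^ n) x₁')) ↔
        (∃ (y₂ : C₂) (z₃ : C₃), (d₂ ^ n) y₂ = 0 ∧
          x₃ = β y₂ + (d₃ ^ (N - n)) z₃)) := by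
  intro x₃ _
  constructor
  · rintro ⟨x₂, x₁', rfl, hx⟩
    have hβα : β (α x₁') = 0 :=
      LinearMap.mem_ker.mp (hexact ▸ LinearMap.mem_range_self α x₁')
    refine ⟨x₂ - α x₁', 0, ?_, ?_⟩
    · rw [map_sub, hx, Module.End.pow_apply_comm hαd, sub_self]
    · rw [map_sub, hβα, sub_zero, map_zero, add_zero]
  · rintro ⟨y₂, z₃, hy, rfl⟩
    obtain ⟨w, rfl⟩ := hβ z₃
    refine ⟨y₂ + (d₂ ^ (N - n)) w, 0, ?_, ?_⟩
    · rw [map_add, Module.End.pow_apply_comm hβd]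
    · rw [map_add, hy, zero_add, ← Module.End.mul_apply, ← pow_add,
        Nat.add_sub_of_le (by omega : n ≤ N), hd₂, LinearMap.zero_apply, map_zero, map_zero]
end

section
/- Let N ≥ 2 and n ≥ 1 be integers. Let A be the quotient of the free ℝ-algebra on generators θ¹, …, θⁿ by the two-sided ideal generated by the elements Σ_{σ ∈ S_N} θ^{λ_{σ(1)}} ⋯ θ^{λ_{σ(N)}} for all λ₁, …, λ_N ∈ {1, …, n}, where S_N is the symmetric group on {1, …, N}; A inherits the ℕ-grading by word length since these relations are homogeneous of degree N. On A ⊗ C^∞(ℝⁿ, ℝ) define the ℝ-linear map d by d(a ⊗ f) = (−1)^m Σ_{λ=1}^{n} (a·θ^λ) ⊗ ∂_λ f for a ∈ A homogeneous of degree m and f smooth, where ∂_λ f is the partial derivative of f in the λ-th coordinate direction. Then d^N = 0. -/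
open TensorProduct

noncomputable section

/-- The symmetrized monomial `Σ_{σ ∈ S_N} θ^{λ_{σ(1)}} ⋯ θ^{λ_{σ(N)}}` in the
free `ℝ`-algebra on `n` generators. -/
def relSum (N n : ℕ) (lam : Fin N → Fin n) : FreeAlgebra ℝ (Fin n) :=
  ∑ σ : Equiv.Perm (Fin N), (List.ofFn fun i => FreeAlgebra.ι ℝ (lam (σ i))).prod

/-- The relation identifying each symmetrized monomial of degree `N` with `0`. -/
def SymRel (N n : ℕ) (a b : FreeAlgebra ℝ (Fin n)) : Prop :=
  (∃ lam : Fin N → Fin n, a = relSum N n lam) ∧ b = 0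

/-- The `N`-homogeneous algebra `A`: the quotient of the free `ℝ`-algebra on
`θ¹, …, θⁿ` by the two-sided ideal generated by the symmetrized monomials of
degree `N`. -/
def NSymAlg (N n : ℕ) : Type := RingQuot (SymRel N n)

instance (N n : ℕ) : Ring (NSymAlg N n) := inferInstanceAs (Ring (RingQuot (SymRel N n)))

instance (N n : ℕ) : Algebra ℝ (NSymAlg N n) :=
  inferInstanceAs (Algebra ℝ (RingQuot (SymRel N n)))

/-- The generators `θ^λ` of `A`. -/
def theta (N n : ℕ) (lam : Fin n) : NSymAlg N n :=
  RingQuot.mkAlgHom ℝ (SymRel N n) (FreeAlgebra.ι ℝ lam)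

/-- The `ℝ`-module `C^∞(ℝⁿ, ℝ)` of smooth real-valued functions on `ℝⁿ`. -/
def SmoothFns (n : ℕ) : Submodule ℝ ((Fin n → ℝ) → ℝ) where
  carrier := {f | ContDiff ℝ (⊤ : ℕ∞) f}
  add_mem' := fun {a b} (hf : ContDiff ℝ (⊤ : ℕ∞) a) (hg : ContDiff ℝ (⊤ : ℕ∞) b) =>
    hf.add hg
  zero_mem' := show ContDiff ℝ (⊤ : ℕ∞) (fun _ => (0 : ℝ)) from contDiff_const
  smul_mem' := fun c f (hf : ContDiff ℝ (⊤ : ℕ∞) f) => hf.const_smul c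

theorem sum_perm_theta_eq_zero (N n : ℕ) (lam : Fin N → Fin n) :
    ∑ σ : Equiv.Perm (Fin N), (List.ofFn fun i => theta N n (lam (σ i))).prod = 0 := by
  have h := RingQuot.mkAlgHom_rel ℝ (s := SymRel N n) ⟨⟨lam, rfl⟩, rfl⟩
  simp only [relSum, map_sum, map_list_prod, List.map_ofFn, map_zero] at h
  exact h

theorem sum_tmul_eq_zero_of_perm_invariant {N n : ℕ} {M : Type*} [AddCommGroup M] [Module ℝ M]
    (a : NSymAlg N n) (g : (Fin N → Fin n) → M)
    (hg : ∀ (lam : Fin N → Fin n) (σ : Equiv.Perm (Fin N)), g (lam ∘ σ) = g lam) :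
    ∑ lam : Fin N → Fin n,
      (a * (List.ofFn fun i => theta N n (lam i)).prod) ⊗ₜ[ℝ] g lam = 0 := by
  set S := ∑ lam : Fin N → Fin n,
    (a * (List.ofFn fun i => theta N n (lam i)).prod) ⊗ₜ[ℝ] g lam
  have reindex (σ : Equiv.Perm (Fin N)) : ∑ lam : Fin N → Fin n,
      (a * (List.ofFn fun i => theta N n (lam (σ i))).prod) ⊗ₜ[ℝ] g lam = S := by
    refine Fintype.sum_equiv (Equiv.arrowCongr σ.symm (Equiv.refl (Fin n))) _ _ fun lam => ?_
    rw [← hg lam σ]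
    rfl
  have h : (Nat.factorial N : ℝ) • S = 0 := by
    calc (Nat.factorial N : ℝ) • S = ∑ _σ : Equiv.Perm (Fin N), S := by
          simp [Fintype.card_perm, Nat.cast_smul_eq_nsmul]
      _ = ∑ σ : Equiv.Perm (Fin N), ∑ lam : Fin N → Fin n,
            (a * (List.ofFn fun i => theta N n (lam (σ i))).prod) ⊗ₜ[ℝ] g lam :=
          Finset.sum_congr rfl fun σ _ => (reindex σ).symm
      _ = 0 := by
          rw [Finset.sum_comm]
          refine Finset.sum_eq_zero fun lam _ => ?_
          rw [← TensorProduct.sum_tmul, ← Finset.mul_sum, sum_perm_theta_eq_zero, mul_zero,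
            TensorProduct.zero_tmul]
  exact (smul_eq_zero.mp h).resolve_left (by exact_mod_cast N.factorial_ne_zero)

theorem SmoothFns.commute_of_eq_fderiv {n : ℕ} {pd : Fin n → Module.End ℝ (SmoothFns n)}
    (hpd : ∀ (lam : Fin n) (f : SmoothFns n) (x : Fin n → ℝ),
      ((pd lam f : (Fin n → ℝ) → ℝ) x) =
        fderiv ℝ (f : (Fin n → ℝ) → ℝ) x (Pi.single lam 1))
    (i j : Fin n) : Commute (pd i) (pd j) := by
  have second (i j : Fin n) (f : SmoothFns n) (x : Fin n → ℝ) :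
      (pd i (pd j f) : (Fin n → ℝ) → ℝ) x =
        fderiv ℝ (fderiv ℝ (f : (Fin n → ℝ) → ℝ)) x (Pi.single i 1) (Pi.single j 1) := by
    have hf : ContDiff ℝ (⊤ : ℕ∞) (f : (Fin n → ℝ) → ℝ) := f.2
    have hd : DifferentiableAt ℝ (fderiv ℝ (f : (Fin n → ℝ) → ℝ)) x :=
      (hf.fderiv_right (m := 1) (WithTop.coe_le_coe.mpr le_top)).differentiable one_ne_zero x
    rw [hpd, funext (hpd j f), fderiv_clm_apply hd (differentiableAt_const _)]
    simp
  refine LinearMap.ext fun f => Subtype.ext (funext fun x => ?_)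
  have hf : ContDiff ℝ (⊤ : ℕ∞) (f : (Fin n → ℝ) → ℝ) := f.2
  have hsymm : IsSymmSndFDerivAt ℝ (f : (Fin n → ℝ) → ℝ) x :=
    hf.contDiffAt.isSymmSndFDerivAt (by simpa using WithTop.coe_le_coe.mpr (le_top (a := (2 : ℕ∞))))
  exact (second i j f x).trans ((hsymm _ _).trans (second j i f x).symm)

theorem exists_pow_apply_tmul {R M ι : Type*} [Ring R] [Algebra ℝ R] [AddCommGroup M]
    [Module ℝ M] [Fintype ι] (t : ι → R) (𝒜 : ℕ → Submodule ℝ R)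
    (ht : ∀ m, ∀ a ∈ 𝒜 m, ∀ i, a * t i ∈ 𝒜 (m + 1))
    (p : ι → Module.End ℝ M) (hp : ∀ i j, Commute (p i) (p j))
    (D : Module.End ℝ (R ⊗[ℝ] M))
    (hD : ∀ (m : ℕ) (a : R), a ∈ 𝒜 m → ∀ f : M,
      D (a ⊗ₜ[ℝ] f) = ((-1 : ℝ)) ^ m • ∑ i, (a * t i) ⊗ₜ[ℝ] (p i f))
    (k m : ℕ) :
    ∃ c : ℝ, ∀ a ∈ 𝒜 m, ∀ f : M, (D ^ k) (a ⊗ₜ[ℝ] f) = c • ∑ lam : Fin k → ι,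
      (a * (List.ofFn fun i => t (lam i)).prod) ⊗ₜ[ℝ] ((List.ofFn fun i => p (lam i)).prod f) := by
  induction k generalizing m with
  | zero => exact ⟨1, fun a _ f => by simp⟩
  | succ k ih =>
    obtain ⟨c, hc⟩ := ih (m + 1)
    refine ⟨(-1) ^ m * c, fun a ha f => ?_⟩
    rw [pow_succ, Module.End.mul_apply, hD m a ha, map_smul, map_sum, mul_smul,
      ← (Fin.consEquiv fun _ : Fin (k + 1) => ι).sum_comp, Fintype.sum_prod_type]
    congr 1
    rw [Finset.smul_sum]
    refine Finset.sum_congr rfl fun i _ => ?_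
    rw [hc _ (ht m a ha i)]
    congr 1
    refine Finset.sum_congr rfl fun lam _ => ?_
    have hcomm : Commute (p i) (List.ofFn fun j => p (lam j)).prod :=
      Commute.list_prod_right _ _ fun x hx => by
        obtain ⟨j, rfl⟩ := List.mem_ofFn.mp hx
        exact hp i (lam j)
    simp only [Fin.consEquiv_apply, List.ofFn_succ, Fin.cons_zero, Fin.cons_succ, List.prod_cons,
      hcomm.eq, mul_assoc, Module.End.mul_apply]

theorem prod_ofFn_comp_perm {G : Type*} [Monoid G] {k : ℕ} (g : Fin k → G)
    (hg : ∀ i j, Commute (g i) (g j)) (σ : Equiv.Perm (Fin k)) :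
    (List.ofFn (g ∘ σ)).prod = (List.ofFn g).prod := by
  refine List.Perm.prod_eq' (σ.ofFn_comp_perm g) (List.pairwise_iff_get.mpr fun i j _ => ?_)
  simpa using hg _ _

/-- On `A ⊗ C^∞(ℝⁿ, ℝ)`, the map `d(a ⊗ f) = (−1)^m Σ_λ (a·θ^λ) ⊗ ∂_λ f`
(for `a` homogeneous of degree `m`) satisfies `d^N = 0`.  Here `𝒜` is the
`ℕ`-grading of `A` by word length (for which the generators have degree `1`
and which is multiplicative), `pd λ` is the `λ`-th partial derivative on
smooth functions, and `D` is the `ℝ`-linear map determined by the formula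
above. -/
theorem symAlg_differential_pow_N_eq_zero (N n : ℕ) (hN : 2 ≤ N) (hn : 1 ≤ n)
    (𝒜 : ℕ → Submodule ℝ (NSymAlg N n))
    (hA : DirectSum.IsInternal 𝒜)
    (hone : (1 : NSymAlg N n) ∈ 𝒜 0)
    (hθ : ∀ lam : Fin n, theta N n lam ∈ 𝒜 1)
    (hmul : ∀ (p q : ℕ), ∀ a ∈ 𝒜 p, ∀ b ∈ 𝒜 q, a * b ∈ 𝒜 (p + q))
    (pd : Fin n → (SmoothFns n →ₗ[ℝ] SmoothFns n))
    (hpd : ∀ (lam : Fin n) (f : SmoothFns n) (x : Fin n → ℝ),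
      ((pd lam f : (Fin n → ℝ) → ℝ) x) =
        fderiv ℝ (f : (Fin n → ℝ) → ℝ) x (Pi.single lam 1))
    (D : Module.End ℝ (NSymAlg N n ⊗[ℝ] SmoothFns n))
    (hD : ∀ (m : ℕ) (a : NSymAlg N n), a ∈ 𝒜 m → ∀ f : SmoothFns n,
      D (a ⊗ₜ[ℝ] f) = ((-1 : ℝ)) ^ m •
        ∑ lam : Fin n, (a * theta N n lam) ⊗ₜ[ℝ] (pd lam f)) :
    D ^ N = 0 := by
  have hcomm := SmoothFns.commute_of_eq_fderiv hpd
  have hzero (m : ℕ) (a : NSymAlg N n) (ha : a ∈ 𝒜 m) (f : SmoothFns n) :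
      (D ^ N) (a ⊗ₜ[ℝ] f) = 0 := by
    obtain ⟨c, hc⟩ := exists_pow_apply_tmul (theta N n) 𝒜
      (fun m a ha i => hmul m 1 a ha _ (hθ i)) pd hcomm D hD N m
    rw [hc a ha f, sum_tmul_eq_zero_of_perm_invariant, smul_zero]
    intro lam σ
    exact congrArg (fun T : Module.End ℝ (SmoothFns n) => T f)
      (prod_ofFn_comp_perm (fun i => pd (lam i)) (fun i j => hcomm _ _) σ)
  refine TensorProduct.ext' fun a f => ?_
  have ha : a ∈ ⨆ m, 𝒜 m := hA.submodule_iSup_eq_top ▸ Submodule.mem_top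
  induction ha using Submodule.iSup_induction' with
  | mem m a ha => exact hzero m a ha f
  | zero => simp
  | add a b _ _ iha ihb => rw [TensorProduct.add_tmul, map_add, map_add, iha, ihb]

end
end
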